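/- arXiv:0908.2899 — 4 statements merged into one kernel-verified Lean document; each statement's English description precedes it below -/
import Mathlib

section
/- The linking-vector map lk̃ is invariant under the first (Q_{α,k},R_{α,k},S_{α,k})-homotopy move: if w₁ = (𝒜, xAAy) with ‖A‖ ∈ Q_{α,k} and w₂ = (𝒜∖{A}, xy), then lk̃(w₁) = lk̃(w₂). -/
/-- A word over alphabet `β`: a list of occurrences `(n, b)` of letters with
name `n` and projection `b ∈ β`. -/
abbrev Word (β : Type) := List (ℕ × β)

/-- `w` is a nanoword: every occurring letter occurs exactly twice, and a letter
name determines its projection. -/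
def isNanoW {β : Type} [DecidableEq β] (w : Word β) : Prop :=
  ∀ p ∈ w, w.count p = 2 ∧ ∀ q ∈ w, q.1 = p.1 → q.2 = p.2

/-- The three `(Q,R,S)`-homotopy moves on words. -/
inductive WMove {β : Type} (Q : Set β) (R : Set (β × β)) (S : Set (β × β × β)) :
    Word β → Word β → Prop
  | m1 (x y : Word β) (n : ℕ) (a : β) (h : a ∈ Q) :
      WMove Q R S (x ++ [(n, a), (n, a)] ++ y) (x ++ y)
  | m2 (x y z : Word β) (n m : ℕ) (a b : β) (h : (a, b) ∈ R) :
      WMove Q R S (x ++ [(n, a), (m, b)] ++ y ++ [(m, b), (n, a)] ++ z) (x ++ y ++ z)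
  | m3 (x y z t : Word β) (n m p : ℕ) (a b c : β) (h : (a, b, c) ∈ S) :
      WMove Q R S
        (x ++ [(n, a), (m, b)] ++ y ++ [(n, a), (p, c)] ++ z ++ [(m, b), (p, c)] ++ t)
        (x ++ [(m, b), (n, a)] ++ y ++ [(p, c), (n, a)] ++ z ++ [(p, c), (m, b)] ++ t)

/-- Isomorphism of words: an injective renaming of letter names. -/
def WIso {β : Type} (w₁ w₂ : Word β) : Prop :=
  ∃ f : Equiv.Perm ℕ, w₂ = w₁.map fun q => (f q.1, q.2)

/-- One step of `(Q,R,S)`-homotopy of words. -/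
def WStep {β : Type} (Q : Set β) (R : Set (β × β)) (S : Set (β × β × β))
    (w₁ w₂ : Word β) : Prop :=
  WIso w₁ w₂ ∨ WMove Q R S w₁ w₂ ∨ WMove Q R S w₂ w₁

/-- `(Q,R,S)`-homotopy of words. -/
def WHomotopic {β : Type} (Q : Set β) (R : Set (β × β)) (S : Set (β × β × β)) :
    Word β → Word β → Prop :=
  Relation.ReflTransGen (WStep Q R S)

def Qk (α : Type) : Set (α × ℕ × ℕ) := {p | p.2.1 = p.2.2}

/-- `R_{α,k} = {(a_{ij}, τ(a)_{ij})}`. -/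
def Rk {α : Type} (τ : α → α) : Set ((α × ℕ × ℕ) × (α × ℕ × ℕ)) :=
  {pr | pr.2 = (τ pr.1.1, pr.1.2)}

/-- `S_{α,k} = {(a_{ij}, b_{il}, c_{jl}) : (a,b,c) ∈ S, 1 ≤ i ≤ j ≤ l ≤ k}`. -/
def Sk {α : Type} (S : Set (α × α × α)) (k : ℕ) :
    Set ((α × ℕ × ℕ) × (α × ℕ × ℕ) × (α × ℕ × ℕ)) :=
  {tr | ∃ a b c i j l, (a, b, c) ∈ S ∧ 1 ≤ i ∧ i ≤ j ∧ j ≤ l ∧ l ≤ k ∧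
    tr = ((a, i, j), (b, i, l), (c, j, l))}

/-- The abelian group `π(α,τ)` generated by the elements of `α` subject to
`ab = ba` and `a·τ(a) = 1` (written additively). -/
def piGroup (α : Type) (τ : α → α) :=
  FreeAbelianGroup α ⧸ AddSubgroup.closure
    {x : FreeAbelianGroup α | ∃ a : α, x = FreeAbelianGroup.of a + FreeAbelianGroup.of (τ a)}

instance (α : Type) (τ : α → α) : AddCommGroup (piGroup α τ) :=
  QuotientAddGroup.Quotient.addCommGroup _

/-- The canonical projection onto `π(α,τ)`. -/
def pmk {α : Type} (τ : α → α) : FreeAbelianGroup α → piGroup α τ :=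
  QuotientAddGroup.mk

/-- The `(i,j)` entry `l̃_w(i,j) = ∏_{A ∈ 𝒜_{ij}} |A| ∈ π(α,τ)` of the linking
vector of a nanoword `w` over `α_k` (each letter contributes once: the two
occurrences of a letter are identical entries, so `w.dedup` lists the letters). -/
def lkv {α : Type} [DecidableEq α] (τ : α → α) (w : Word (α × ℕ × ℕ)) (i j : ℕ) :
    piGroup α τ :=
  ((w.dedup.filter fun q => q.2.2.1 = i ∧ q.2.2.2 = j).map fun q =>
    pmk τ (FreeAbelianGroup.of q.2.1)).sum

/-- the linking vector is invariant under the first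
`(Q_{α,k},R_{α,k},S_{α,k})`-homotopy move: if `w₁ = xAAy` with `‖A‖ ∈ Q_{α,k}`
and `w₂ = xy` then `lk̃(w₁) = lk̃(w₂)`. -/
theorem stmt8 {α : Type} [DecidableEq α] (τ : α → α) (hτ : Function.Involutive τ)
    (x y : Word (α × ℕ × ℕ)) (n : ℕ) (v : α × ℕ × ℕ) (hv : v ∈ Qk α)
    (hnano : isNanoW (x ++ [(n, v), (n, v)] ++ y)) :
    ∀ i j : ℕ, i < j →
      lkv τ (x ++ [(n, v), (n, v)] ++ y) i j = lkv τ (x ++ y) i j := by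
  intro i j hij
  have hvij : ¬ (v.2.1 = i ∧ v.2.2 = j) := by
    rintro ⟨rfl, rfl⟩
    exact hij.ne hv
  refine (List.Perm.map _ ?_).sum_eq
  refine (List.perm_ext_iff_of_nodup ((List.nodup_dedup _).filter _)
    ((List.nodup_dedup _).filter _)).2 fun q => ?_
  have hq : q = (n, v) → ¬ (q.2.2.1 = i ∧ q.2.2.2 = j) := by
    rintro rfl
    exact hvij
  simp only [List.mem_filter, List.mem_dedup, List.mem_append, List.mem_cons,
    List.not_mem_nil, decide_eq_true_eq]
  tauto
end

section
/- The linking-vector map lk̃ is invariant under the second (Q_{α,k},R_{α,k},S_{α,k})-homotopy move: if w₁ = (𝒜, xAByBAz) with ‖A‖ = τ_k(‖B‖) and w₂ = (𝒜∖{A,B}, xyz), then lk̃(w₁) = lk̃(w₂). -/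
theorem perm_cons_cons_of_nested {γ : Type} (x y z : List γ) (A B : γ) :
    (x ++ [A, B] ++ y ++ [B, A] ++ z).Perm (A :: B :: A :: B :: (x ++ y ++ z)) := by
  classical
  rw [List.perm_iff_count]
  intro c
  simp only [List.count_append, List.count_cons, List.count_nil]
  omega

theorem isNanoW.ne_and_notMem {β : Type} [DecidableEq β] {x y z : Word β} {A B : ℕ × β}
    (h : isNanoW (x ++ [A, B] ++ y ++ [B, A] ++ z)) :
    A ≠ B ∧ A ∉ x ++ y ++ z ∧ B ∉ x ++ y ++ z := by
  have hcA := (h A (by simp)).1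
  have hcB := (h B (by simp)).1
  rw [(perm_cons_cons_of_nested x y z A B).count_eq] at hcA hcB
  have hAB : A ≠ B := by
    rintro rfl
    simp at hcB
  refine ⟨hAB, ?_, ?_⟩ <;> rw [← List.count_eq_zero]
  · simpa [List.count_cons, hAB.symm] using hcA
  · simpa [List.count_cons, hAB] using hcB

theorem lkv_eq_of_perm {α : Type} [DecidableEq α] (τ : α → α) {v w : Word (α × ℕ × ℕ)}
    (h : v.Perm w) (i j : ℕ) : lkv τ v i j = lkv τ w i j :=
  ((h.dedup.filter _).map _).sum_eq

theorem lkv_cons_of_mem {α : Type} [DecidableEq α] (τ : α → α) {p : ℕ × α × ℕ × ℕ}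
    {w : Word (α × ℕ × ℕ)} (h : p ∈ w) (i j : ℕ) : lkv τ (p :: w) i j = lkv τ w i j := by
  simp only [lkv, List.dedup_cons_of_mem h]

theorem lkv_cons_of_notMem {α : Type} [DecidableEq α] (τ : α → α) {p : ℕ × α × ℕ × ℕ}
    {w : Word (α × ℕ × ℕ)} (h : p ∉ w) (i j : ℕ) :
    lkv τ (p :: w) i j =
      (if p.2.2.1 = i ∧ p.2.2.2 = j then pmk τ (FreeAbelianGroup.of p.2.1) else 0) +
        lkv τ w i j := by
  simp only [lkv, List.dedup_cons_of_notMem h, List.filter_cons, decide_eq_true_eq]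
  split_ifs <;> simp

theorem pmk_of_apply_add_pmk_of {α : Type} {τ : α → α} (hτ : Function.Involutive τ) (b : α) :
    pmk τ (FreeAbelianGroup.of (τ b)) + pmk τ (FreeAbelianGroup.of b) = 0 :=
  (QuotientAddGroup.eq_zero_iff _).mpr (AddSubgroup.subset_closure ⟨τ b, by rw [hτ b]⟩)

/-- the linking vector is invariant under the second
`(Q_{α,k},R_{α,k},S_{α,k})`-homotopy move: if `w₁ = xAByBAz` with
`‖A‖ = τ_k(‖B‖)` and `w₂ = xyz` then `lk̃(w₁) = lk̃(w₂)`. -/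
theorem stmt9 {α : Type} [DecidableEq α] (τ : α → α) (hτ : Function.Involutive τ)
    (x y z : Word (α × ℕ × ℕ)) (nA nB : ℕ) (b : α) (i₀ j₀ : ℕ)
    (hnano : isNanoW (x ++ [(nA, (τ b, i₀, j₀)), (nB, (b, i₀, j₀))] ++ y ++
      [(nB, (b, i₀, j₀)), (nA, (τ b, i₀, j₀))] ++ z)) :
    ∀ i j : ℕ, i < j →
      lkv τ (x ++ [(nA, (τ b, i₀, j₀)), (nB, (b, i₀, j₀))] ++ y ++
        [(nB, (b, i₀, j₀)), (nA, (τ b, i₀, j₀))] ++ z) i j =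
      lkv τ (x ++ y ++ z) i j := by
  intro i j _
  set A : ℕ × α × ℕ × ℕ := (nA, (τ b, i₀, j₀)) with hA
  set B : ℕ × α × ℕ × ℕ := (nB, (b, i₀, j₀)) with hB
  obtain ⟨hAB, hAw, hBw⟩ := hnano.ne_and_notMem
  rw [lkv_eq_of_perm τ (perm_cons_cons_of_nested x y z A B), lkv_cons_of_mem τ (by simp),
    lkv_cons_of_mem τ (by simp),
    lkv_cons_of_notMem τ (by simpa [hAB] using hAw), lkv_cons_of_notMem τ hBw, ← add_assoc]
  simp only [hA, hB]
  split_ifs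
  · rw [pmk_of_apply_add_pmk_of hτ, zero_add]
  · simp
end

section
/- The linking vector lk̃ is a (Q_{α,k}, R_{α,k}, S_{α,k})-homotopy invariant of nanowords over α_k: if two nanowords over α_k are (Q_{α,k},R_{α,k},S_{α,k})-homotopic then their linking vectors are equal. -/
theorem List.sum_map_filter_eq_sum_map_ite {ι M : Type*} [AddMonoid M] (l : List ι) (p : ι → Prop)
    [DecidablePred p] (f : ι → M) :
    ((l.filter fun q => p q).map f).sum = (l.map fun q => if p q then f q else 0).sum := by
  induction l with
  | nil => simp
  | cons a l ih => by_cases h : p a <;> simp [h, ih]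

/-- The sum of the values of `g` at the entries of `w`, each weighted by half its number of
occurrences, rounded down. -/
def halfCountSum {ι M : Type*} [DecidableEq ι] [AddCommMonoid M] (g : ι → M) (w : List ι) : M :=
  ∑ q ∈ w.toFinset, (w.count q / 2) • g q

section HalfCountSum

variable {ι M : Type*} [DecidableEq ι] [AddCommMonoid M] (g : ι → M)

theorem halfCountSum_eq_sum_of_subset {w : List ι} {s : Finset ι} (h : w.toFinset ⊆ s) :
    halfCountSum g w = ∑ q ∈ s, (w.count q / 2) • g q := by
  refine Finset.sum_subset h fun q _ hq => ?_
  rw [List.count_eq_zero_of_not_mem (by simpa using hq)]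
  simp

theorem halfCountSum_perm {v w : List ι} (h : v.Perm w) :
    halfCountSum g v = halfCountSum g w := by
  unfold halfCountSum
  rw [List.toFinset_eq_of_perm _ _ h]
  simp only [h.count_eq]

theorem halfCountSum_cons_cons_self (q : ι) (w : List ι) :
    halfCountSum g (q :: q :: w) = g q + halfCountSum g w := by
  have hq : q ∈ (q :: q :: w).toFinset := by simp
  have hw : w.toFinset ⊆ (q :: q :: w).toFinset := by
    intro x hx
    simp_all
  rw [halfCountSum_eq_sum_of_subset g hw, halfCountSum, ← Finset.add_sum_erase _ _ hq,
    ← Finset.add_sum_erase _ (fun r => (w.count r / 2) • g r) hq, ← add_assoc]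
  congr 1
  · rw [List.count_cons_self, List.count_cons_self,
      show (w.count q + 1 + 1) / 2 = 1 + w.count q / 2 by omega, add_smul, one_smul]
  · refine Finset.sum_congr rfl fun r hr => ?_
    have hne : q ≠ r := (Finset.ne_of_mem_erase hr).symm
    rw [List.count_cons_of_ne hne, List.count_cons_of_ne hne]

theorem halfCountSum_map {f : ι → ι} (hf : f.Injective) (hg : ∀ q, g (f q) = g q) (w : List ι) :
    halfCountSum g (w.map f) = halfCountSum g w := by
  unfold halfCountSum
  have himage : (w.map f).toFinset = w.toFinset.image f := by
    ext
    simp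
  rw [himage, Finset.sum_image hf.injOn]
  simp only [List.count_map_of_injective w f hf, hg]

theorem halfCountSum_eq_sum_dedup {w : List ι} (h : ∀ q ∈ w, w.count q = 2) :
    halfCountSum g w = (w.dedup.map g).sum := by
  have hdedup : w.dedup.toFinset = w.toFinset := by
    ext
    simp
  rw [← List.sum_toFinset g w.nodup_dedup, hdedup]
  refine Finset.sum_congr rfl fun q hq => ?_
  rw [h q (by simpa using hq)]
  simp

end HalfCountSum

theorem pmk_of_add_pmk_of {α : Type} (τ : α → α) (a : α) :
    pmk τ (FreeAbelianGroup.of a) + pmk τ (FreeAbelianGroup.of (τ a)) = 0 :=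
  (QuotientAddGroup.eq_zero_iff _).2 (AddSubgroup.subset_closure ⟨a, rfl⟩)

/-- The contribution of a letter to the `(i,j)` entry of the linking vector. -/
def linkWeight {α : Type} (τ : α → α) (i j : ℕ) (q : ℕ × α × ℕ × ℕ) : piGroup α τ :=
  if q.2.2.1 = i ∧ q.2.2.2 = j then pmk τ (FreeAbelianGroup.of q.2.1) else 0

section Invariance

variable {α : Type} [DecidableEq α] (τ : α → α)

theorem lkv_eq_halfCountSum {w : Word (α × ℕ × ℕ)} (h : isNanoW w) (i j : ℕ) :
    lkv τ w i j = halfCountSum (linkWeight τ i j) w := by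
  rw [halfCountSum_eq_sum_dedup]
  · exact List.sum_map_filter_eq_sum_map_ite _ _ _
  · intro q hq
    convert (h q hq).1

variable {τ} {S : Set (α × α × α)} {k i j : ℕ} {v w : Word (α × ℕ × ℕ)}

theorem WMove.halfCountSum_eq (hij : i < j) (h : WMove (Qk α) (Rk τ) (Sk S k) v w) :
    halfCountSum (linkWeight τ i j) v = halfCountSum (linkWeight τ i j) w := by
  cases h with
  | m1 x y n a h =>
    have hp : (x ++ [(n, a), (n, a)] ++ y).Perm ((n, a) :: (n, a) :: (x ++ y)) := by
      rw [List.perm_iff_count]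
      intro q
      simp only [List.count_append, List.count_cons, List.count_nil]
      omega
    have h0 : linkWeight τ i j (n, a) = 0 := by
      have h' : a.2.1 = a.2.2 := h
      refine if_neg fun hc => ?_
      simp only at hc
      omega
    rw [halfCountSum_perm _ hp, halfCountSum_cons_cons_self, h0, zero_add]
  | m2 x y z n m a b h =>
    have hp : (x ++ [(n, a), (m, b)] ++ y ++ [(m, b), (n, a)] ++ z).Perm
        ((n, a) :: (n, a) :: (m, b) :: (m, b) :: (x ++ y ++ z)) := by
      rw [List.perm_iff_count]
      intro q
      simp only [List.count_append, List.count_cons, List.count_nil]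
      omega
    have h0 : linkWeight τ i j (n, a) + linkWeight τ i j (m, b) = 0 := by
      have hb : b = (τ a.1, a.2) := h
      subst hb
      unfold linkWeight
      split_ifs
      · exact pmk_of_add_pmk_of τ a.1
      · exact add_zero 0
    rw [halfCountSum_perm _ hp, halfCountSum_cons_cons_self, halfCountSum_cons_cons_self,
      ← add_assoc, h0, zero_add]
  | m3 x y z t n m p a b c h =>
    refine halfCountSum_perm _ ?_
    rw [List.perm_iff_count]
    intro q
    simp only [List.count_append, List.count_cons, List.count_nil]
    omega

theorem WIso.halfCountSum_eq (h : WIso v w) :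
    halfCountSum (linkWeight τ i j) v = halfCountSum (linkWeight τ i j) w := by
  obtain ⟨f, rfl⟩ := h
  refine (halfCountSum_map (linkWeight τ i j) (f := fun q => (f q.1, q.2)) (fun p q hpq => ?_)
    (fun q => rfl) v).symm
  simp only [Prod.mk.injEq, f.injective.eq_iff] at hpq
  exact Prod.ext hpq.1 hpq.2

theorem WHomotopic.halfCountSum_eq (hij : i < j) (h : WHomotopic (Qk α) (Rk τ) (Sk S k) v w) :
    halfCountSum (linkWeight τ i j) v = halfCountSum (linkWeight τ i j) w := by
  induction h with
  | refl => rfl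
  | tail _ hs ih =>
    rcases hs with hs | hs | hs
    · exact ih.trans hs.halfCountSum_eq
    · exact ih.trans (hs.halfCountSum_eq hij)
    · exact ih.trans (hs.halfCountSum_eq hij).symm

end Invariance

/-- the linking vector `lk̃` is a
`(Q_{α,k},R_{α,k},S_{α,k})`-homotopy invariant of nanowords over `α_k`. -/
theorem stmt10 {α : Type} [DecidableEq α] (τ : α → α) (hτ : Function.Involutive τ)
    (S : Set (α × α × α)) (k : ℕ) (w₁ w₂ : Word (α × ℕ × ℕ))
    (h₁ : isNanoW w₁) (h₂ : isNanoW w₂)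
    (h : WHomotopic (Qk α) (Rk τ) (Sk S k) w₁ w₂) :
    ∀ i j : ℕ, i < j → lkv τ w₁ i j = lkv τ w₂ i j := by
  intro i j hij
  rw [lkv_eq_halfCountSum τ h₁, lkv_eq_halfCountSum τ h₂]
  exact h.halfCountSum_eq hij
end

section
/- The invariants lk̃ and w̃ are not S_{α,k}-homotopy invariants: for α = {a} with τ = id and k = 2, the nanoword w₁ = AA with ‖A‖ = a_{12} and the empty nanoword w₂ = ∅ are S_{α,2}-homotopic (related by the unrestricted first move), but lk̃(w₁) = a ≠ 1 = lk̃(w₂) in π(α,τ), and w̃(w₁) = (1,1) ≠ (0,0) = w̃(w₂). -/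
/-- `Card(𝒜_{ij})` as an element of `ℤ/2ℤ`: the number of letters of `w` whose
projection has subscripts `(i,j)` (each letter occurs as two identical entries,
so `w.dedup` lists the letters once). -/
def cardA {α : Type} [DecidableEq α] (w : Word (α × ℕ × ℕ)) (i j : ℕ) : ZMod 2 :=
  ((w.dedup.filter fun q => q.2.2.1 = i ∧ q.2.2.2 = j).length : ZMod 2)

/-- The `l`-th entry of the component length vector:
`w̃(l) = Σ_{i<l} Card(𝒜_{il}) + Σ_{l<i} Card(𝒜_{li})  (mod 2)`. -/
def wcl {α : Type} [DecidableEq α] (w : Word (α × ℕ × ℕ)) (k l : ℕ) : ZMod 2 :=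
  ∑ i ∈ Finset.Icc 1 k,
    ((if i < l then cardA w i l else 0) + (if l < i then cardA w l i else 0))

/-- The generator `a` of `π({a}, id)` is nontrivial. -/
theorem pmk_id_of_unit_ne_zero : pmk (id : Unit → Unit) (FreeAbelianGroup.of ()) ≠ 0 := by
  intro h
  let φ : FreeAbelianGroup Unit →+ ZMod 2 := FreeAbelianGroup.lift fun _ => 1
  have hle : AddSubgroup.closure {x : FreeAbelianGroup Unit | ∃ a : Unit,
      x = FreeAbelianGroup.of a + FreeAbelianGroup.of (id a)} ≤ φ.ker := by
    rw [AddSubgroup.closure_le]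
    rintro x ⟨a, rfl⟩
    simp only [SetLike.mem_coe, AddMonoidHom.mem_ker, map_add, φ, FreeAbelianGroup.lift_apply_of]
    decide
  have hφ : φ (FreeAbelianGroup.of ()) = 0 := hle ((QuotientAddGroup.eq_zero_iff _).mp h)
  simp [φ] at hφ

theorem lkv_letter_one_two :
    lkv (id : Unit → Unit) [((0 : ℕ), ((), 1, 2)), ((0 : ℕ), ((), 1, 2))] 1 2 =
      pmk id (FreeAbelianGroup.of ()) := by
  simp [lkv, List.dedup_cons_of_mem]

/-- `lk̃` and `w̃` are not `S_{α,k}`-homotopy invariants: over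
`α = {a}` (encoded as `Unit`) with `τ = id` and `k = 2`, the nanoword `w₁ = AA`
with `‖A‖ = a_{12}` and the empty nanoword `w₂` are `S_{α,2}`-homotopic (via the
unrestricted first move), yet `lk̃(w₁) = a ≠ 1 = lk̃(w₂)` in `π(α,τ) `and
`w̃(w₁) = (1,1) ≠ (0,0) = w̃(w₂)`. -/
theorem stmt12 (S : Set (Unit × Unit × Unit)) :
    WHomotopic Set.univ (Rk (id : Unit → Unit)) (Sk S 2)
      ([((0 : ℕ), ((), 1, 2)), ((0 : ℕ), ((), 1, 2))] : Word (Unit × ℕ × ℕ))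
      ([] : Word (Unit × ℕ × ℕ)) ∧
    lkv (id : Unit → Unit) [((0 : ℕ), ((), 1, 2)), ((0 : ℕ), ((), 1, 2))] 1 2 =
      pmk id (FreeAbelianGroup.of ()) ∧
    lkv (id : Unit → Unit) ([] : Word (Unit × ℕ × ℕ)) 1 2 = 0 ∧
    lkv (id : Unit → Unit) [((0 : ℕ), ((), 1, 2)), ((0 : ℕ), ((), 1, 2))] 1 2 ≠
      lkv (id : Unit → Unit) ([] : Word (Unit × ℕ × ℕ)) 1 2 ∧
    wcl ([((0 : ℕ), ((), 1, 2)), ((0 : ℕ), ((), 1, 2))] : Word (Unit × ℕ × ℕ)) 2 1 = 1 ∧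
    wcl ([((0 : ℕ), ((), 1, 2)), ((0 : ℕ), ((), 1, 2))] : Word (Unit × ℕ × ℕ)) 2 2 = 1 ∧
    wcl ([] : Word (Unit × ℕ × ℕ)) 2 1 = 0 ∧
    wcl ([] : Word (Unit × ℕ × ℕ)) 2 2 = 0 := by
  refine ⟨?_, lkv_letter_one_two, rfl, ?_, by decide, by decide, by decide, by decide⟩
  · exact Relation.ReflTransGen.single
      (Or.inr (Or.inl (WMove.m1 [] [] 0 ((), 1, 2) (Set.mem_univ _))))
  · rw [lkv_letter_one_two]
    exact pmk_id_of_unit_ne_zero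
end
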